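/- arXiv:1512.05838 — 2 statements merged into one kernel-verified Lean document; each statement's English description precedes it below -/
import Mathlib

section
/- Let n ≥ 1 and let M be an n×n complex matrix with Im M positive definite. Then M is invertible and −Im(M⁻¹) = (M⁻¹)* (Im M) (M⁻¹); in particular Im(−M⁻¹) is positive definite, i.e., the set Mₙ⁺(ℂ) of complex n×n matrices with positive definite imaginary part is invariant under the map M ↦ −M⁻¹. -/
open Matrix Complex
open scoped ComplexOrder

/-- The imaginary part `Im M := (M − M*)/(2i)` of a square complex matrix. -/
noncomputable def imPart {n : ℕ} (M : Matrix (Fin n) (Fin n) ℂ) : Matrix (Fin n) (Fin n) ℂ :=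
  ((2 : ℂ) * Complex.I)⁻¹ • (M - Mᴴ)

theorem imPart_neg {n : ℕ} (M : Matrix (Fin n) (Fin n) ℂ) : imPart (-M) = -imPart M := by
  simp only [imPart, conjTranspose_neg, ← smul_neg]
  congr 1
  abel

theorem star_dotProduct_imPart_mulVec_eq_zero {n : ℕ} {M : Matrix (Fin n) (Fin n) ℂ}
    {x : Fin n → ℂ} (hx : M *ᵥ x = 0) : star x ⬝ᵥ (imPart M *ᵥ x) = 0 := by
  have hstar : star x ⬝ᵥ (Mᴴ *ᵥ x) = 0 := by
    rw [dotProduct_mulVec, ← star_mulVec, hx, star_zero, zero_dotProduct]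
  rw [imPart, smul_mulVec, sub_mulVec, hx, dotProduct_smul, dotProduct_sub, hstar]
  simp

theorem isUnit_of_posDef_imPart {n : ℕ} {M : Matrix (Fin n) (Fin n) ℂ}
    (h : (imPart M).PosDef) : IsUnit M := by
  rw [isUnit_iff_isUnit_det, isUnit_iff_ne_zero]
  intro hdet
  obtain ⟨x, hx0, hx⟩ := exists_mulVec_eq_zero_iff.mpr hdet
  exact (h.dotProduct_mulVec_pos hx0).ne' (star_dotProduct_imPart_mulVec_eq_zero hx)

theorem neg_imPart_inv {n : ℕ} {M : Matrix (Fin n) (Fin n) ℂ} (hM : IsUnit M) :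
    -(imPart M⁻¹) = (M⁻¹)ᴴ * imPart M * M⁻¹ := by
  have hdet : IsUnit M.det := (isUnit_iff_isUnit_det M).mp hM
  have hstar : (M⁻¹)ᴴ * Mᴴ = 1 := by
    rw [← conjTranspose_mul, mul_nonsing_inv M hdet, conjTranspose_one]
  rw [imPart, imPart, Matrix.mul_smul, Matrix.smul_mul, Matrix.mul_sub, Matrix.sub_mul, hstar,
    Matrix.mul_assoc, mul_nonsing_inv M hdet, Matrix.mul_one, Matrix.one_mul, ← smul_neg, neg_sub]

/-- If `Im M` is positive definite then `M` is invertible,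
`−Im(M⁻¹) = (M⁻¹)* (Im M) (M⁻¹)`, and `Im(−M⁻¹)` is positive definite; i.e. the set
`Mₙ⁺(ℂ)` of matrices with positive definite imaginary part is invariant under `M ↦ −M⁻¹`. -/
theorem neg_inv_mem_of_posDef_imPart (n : ℕ) (hn : 1 ≤ n) (M : Matrix (Fin n) (Fin n) ℂ)
    (h : (imPart M).PosDef) :
    IsUnit M ∧ -(imPart M⁻¹) = (M⁻¹)ᴴ * imPart M * M⁻¹ ∧ (imPart (-M⁻¹)).PosDef := by
  have hM : IsUnit M := isUnit_of_posDef_imPart h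
  refine ⟨hM, neg_imPart_inv hM, ?_⟩
  rw [imPart_neg, neg_imPart_inv hM]
  exact (IsUnit.posDef_star_left_conjugate_iff
    ((isUnit_nonsing_inv_iff).mpr hM)).mpr h
end

section
/- Let ρ = [[0,1],[−1,0]], J = [[0, ρ],[ρ*, 0]] (4×4, block form), and let T be a 4×4 complex matrix with 2×2 blocks T = [[T₁₁, T₁₂],[T₂₁, T₂₂]] such that J − T*JT is positive definite (so T₁₂ is invertible). Define Γ by Γ₁₁ = T₂₂T₁₂⁻¹, Γ₁₂ = T₂₁ − T₂₂T₁₂⁻¹T₁₁, Γ₂₁ = T₁₂⁻¹, Γ₂₂ = −T₁₂⁻¹T₁₁. Then for every nonzero pair (u₁, u₀) ∈ ℂ² × ℂ², setting (v₁, v₀) = Γ·(u₁, u₀), one has Re(u₀* ρ v₀) − Re(u₁* ρ v₁) > 0. (This is the positivity of the imaginary part of the Dirichlet-to-Neumann map of the layered medium.) -/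
open Matrix Complex
open scoped ComplexOrder

/-- The matrix `ρ = [[0,1],[−1,0]]`. -/
noncomputable def rhoMat : Matrix (Fin 2) (Fin 2) ℂ := !![0, 1; -1, 0]

/-- The matrix `J = [[0, ρ],[ρ*, 0]]`. -/
noncomputable def Jmat : Matrix (Fin 2 ⊕ Fin 2) (Fin 2 ⊕ Fin 2) ℂ :=
  Matrix.fromBlocks 0 rhoMat rhoMatᴴ 0

/-- The matrix `Γ(T)` associated with a `2×2`-block `4×4` matrix
`T = [[T₁₁, T₁₂],[T₂₁, T₂₂]]` with `T₁₂` invertible. -/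
noncomputable def gammaMat (T11 T12 T21 T22 : Matrix (Fin 2) (Fin 2) ℂ) :
    Matrix (Fin 2 ⊕ Fin 2) (Fin 2 ⊕ Fin 2) ℂ :=
  Matrix.fromBlocks (T22 * T12⁻¹) (T21 - T22 * T12⁻¹ * T11) T12⁻¹ (-(T12⁻¹ * T11))

/-- The Hermitian form of `J` is twice the real part of the pairing through `ρ`. -/
lemma star_dotProduct_Jmat_mulVec (u v : Fin 2 → ℂ) :
    (star (Sum.elim u v) ⬝ᵥ (Jmat *ᵥ Sum.elim u v)).re =
      2 * (star u ⬝ᵥ (rhoMat *ᵥ v)).re := by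
  simp [Jmat, rhoMat, Matrix.mulVec, dotProduct, Fin.sum_univ_two, Matrix.fromBlocks,
    Matrix.conjTranspose_apply]
  ring

/-- Positive definiteness of `J − T*JT` says that `T` strictly decreases `Re(u*ρv)`. -/
lemma re_rhoMat_pairing_lt_of_posDef {T11 T12 T21 T22 : Matrix (Fin 2) (Fin 2) ℂ}
    (h : (Jmat -
        (Matrix.fromBlocks T11 T12 T21 T22)ᴴ * Jmat * Matrix.fromBlocks T11 T12 T21 T22).PosDef)
    {u v : Fin 2 → ℂ} (huv : ¬(u = 0 ∧ v = 0)) :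
    (star (T11 *ᵥ u + T12 *ᵥ v) ⬝ᵥ (rhoMat *ᵥ (T21 *ᵥ u + T22 *ᵥ v))).re <
      (star u ⬝ᵥ (rhoMat *ᵥ v)).re := by
  have hne : Sum.elim u v ≠ 0 := by
    intro h0
    exact huv ⟨funext fun i => congrFun h0 (Sum.inl i), funext fun i => congrFun h0 (Sum.inr i)⟩
  have hpos := (Complex.lt_def.mp (h.dotProduct_mulVec_pos hne)).1
  have hT : Matrix.fromBlocks T11 T12 T21 T22 *ᵥ Sum.elim u v =
      Sum.elim (T11 *ᵥ u + T12 *ᵥ v) (T21 *ᵥ u + T22 *ᵥ v) := by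
    simp [Matrix.fromBlocks_mulVec]
  rw [Matrix.sub_mulVec, dotProduct_sub, ← Matrix.mulVec_mulVec, ← Matrix.mulVec_mulVec,
    Matrix.dotProduct_mulVec _ (_ᴴ), ← Matrix.star_mulVec, hT, Complex.sub_re,
    star_dotProduct_Jmat_mulVec, star_dotProduct_Jmat_mulVec, Complex.zero_re] at hpos
  linarith

/-- Positivity of the imaginary part of the Dirichlet-to-Neumann map of a layered medium:
if `J − T*JT` is positive definite (so `T₁₂` is invertible), then for every nonzero pair
`(u₁, u₀)`, setting `(v₁, v₀) = Γ(T)·(u₁, u₀)`, one has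
`Re(u₀* ρ v₀) − Re(u₁* ρ v₁) > 0`. -/
theorem dtn_posImag (T11 T12 T21 T22 : Matrix (Fin 2) (Fin 2) ℂ)
    (h : (Jmat -
        (Matrix.fromBlocks T11 T12 T21 T22)ᴴ * Jmat * Matrix.fromBlocks T11 T12 T21 T22).PosDef) :
    IsUnit T12 ∧
      ∀ u1 u0 : Fin 2 → ℂ, ¬(u1 = 0 ∧ u0 = 0) →
        0 < (star u0 ⬝ᵥ (rhoMat *ᵥ fun i =>
                (gammaMat T11 T12 T21 T22 *ᵥ Sum.elim u1 u0) (Sum.inr i))).re -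
            (star u1 ⬝ᵥ (rhoMat *ᵥ fun i =>
                (gammaMat T11 T12 T21 T22 *ᵥ Sum.elim u1 u0) (Sum.inl i))).re := by
  have hunit : IsUnit T12 := by
    rw [← Matrix.mulVec_injective_iff_isUnit, ← Matrix.coe_mulVecLin,
      injective_iff_map_eq_zero]
    intro v hv
    by_contra hv0
    have hlt := re_rhoMat_pairing_lt_of_posDef h (u := 0) (v := v) fun hc => hv0 hc.2
    rw [Matrix.mulVecLin_apply] at hv
    simp [hv] at hlt
  refine ⟨hunit, fun u1 u0 hu => ?_⟩
  have hdet : IsUnit T12.det := (Matrix.isUnit_iff_isUnit_det _).mp hunit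
  set v0 := T12⁻¹ *ᵥ u1 - T12⁻¹ *ᵥ (T11 *ᵥ u0) with hv0
  have hinr : (fun i => (gammaMat T11 T12 T21 T22 *ᵥ Sum.elim u1 u0) (Sum.inr i)) = v0 := by
    ext i
    simp only [gammaMat, Matrix.fromBlocks_mulVec, hv0, Matrix.neg_mulVec, Sum.elim_comp_inl,
      Sum.elim_comp_inr, Sum.elim_inr, Matrix.mulVec_mulVec, sub_eq_add_neg]
  have hinl : (fun i => (gammaMat T11 T12 T21 T22 *ᵥ Sum.elim u1 u0) (Sum.inl i)) =
      T21 *ᵥ u0 + T22 *ᵥ v0 := by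
    ext i
    simp only [gammaMat, Matrix.fromBlocks_mulVec, hv0, Matrix.sub_mulVec, Matrix.mulVec_sub,
      Sum.elim_comp_inl, Sum.elim_comp_inr, Sum.elim_inl, Matrix.mulVec_mulVec,
      Matrix.mul_assoc, Pi.add_apply, Pi.sub_apply]
    ring
  have hu1 : T11 *ᵥ u0 + T12 *ᵥ v0 = u1 := by
    simp only [hv0, Matrix.mulVec_sub, Matrix.mulVec_mulVec, Matrix.mul_nonsing_inv _ hdet,
      Matrix.mul_nonsing_inv_cancel_left _ _ hdet, Matrix.one_mulVec, add_sub_cancel]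
  have hne : ¬(u0 = 0 ∧ v0 = 0) := by
    rintro ⟨hu0, hv⟩
    refine hu ⟨?_, hu0⟩
    rw [← hu1, hv, hu0]
    simp
  have hlt := re_rhoMat_pairing_lt_of_posDef h hne
  rw [hu1] at hlt
  rw [hinr, hinl]
  exact sub_pos.mpr hlt
end
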